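/- arXiv:1606.01022 — 13 statements merged into one kernel-verified Lean document; each statement's English description precedes it below -/
import Mathlib

section
/- Let N be a positive integer, let m be a positive divisor of N, and let n be a natural number. Then (N/m) · ∑_{d | N} ∑_{l=1}^{gcd(d,m)} gcd( gcd(d,m), n + l·(d/gcd(d,m)) ) = N · ∑_{d | N} gcd(d, m, N/d, N/m, n), where both outer sums run over the positive divisors d of N. -/
open Finset

lemma gcd_mul_mul_of_coprime {a b c d : ℕ} (had : a.Coprime d) (hbc : b.Coprime c)
    (hcd : c.Coprime d) : Nat.gcd (a * b) (c * d) = Nat.gcd a c * Nat.gcd b d := by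
  rw [hcd.gcd_mul, hbc.gcd_mul_right_cancel, had.gcd_mul_left_cancel]

lemma sum_divisors_mul_of_coprime {M N : ℕ} (h : M.Coprime N) (f : ℕ → ℕ) :
    ∑ d ∈ (M * N).divisors, f d = ∑ x ∈ M.divisors, ∑ y ∈ N.divisors, f (x * y) := by
  rw [← sum_product', Nat.divisors_mul, mul_def, sum_image]
  simpa using h.mul_injOn_divisors

lemma card_filter_modEq_Icc_one {g r : ℕ} (hr : 0 < r) (hrg : r ∣ g) (v : ℕ) :
    #{l ∈ Icc 1 g | l ≡ v [MOD r]} = g / r := by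
  obtain ⟨k, rfl⟩ := hrg
  have h := Nat.Ioc_filter_modEq_card 0 (r * k) hr v
  have hr' : (r : ℚ) ≠ 0 := by positivity
  have e : (((r * k : ℕ) : ℚ) - v) / r = ((0 : ℕ) - v) / r + (k : ℕ) := by
    push_cast; field_simp; ring
  rw [e, Int.floor_add_natCast] at h
  rw [Nat.mul_div_cancel_left _ hr]
  have : Icc 1 (r * k) = Ioc 0 (r * k) := rfl
  rw [this]
  zify
  rw [h]
  simp

lemma card_filter_dvd_add_mul {g t : ℕ} (ht : 0 < t) (htg : t ∣ g) (n e : ℕ) :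
    #{l ∈ Icc 1 g | t ∣ n + l * e} =
      g / t * if Nat.gcd t e ∣ n then Nat.gcd t e else 0 := by
  split_ifs with h
  · obtain ⟨c, t', e', hc, hco, rfl, rfl⟩ :=
      Nat.exists_coprime' (m := t) (n := e) (Nat.gcd_pos_of_pos_left e ht)
    have ht' : 0 < t' := Nat.pos_of_mul_pos_right ht
    rw [Nat.gcd_mul_right, hco.gcd_eq_one, one_mul] at h ⊢
    obtain ⟨n', rfl⟩ := h
    obtain ⟨v, hv⟩ : ∃ v, t' ∣ n' + v * e' := by
      obtain rfl | ht1 := Nat.eq_or_lt_of_le (Nat.succ_le_of_lt ht')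
      · exact ⟨0, one_dvd _⟩
      obtain ⟨u, -, hu⟩ := Nat.exists_mul_mod_eq_one_of_coprime hco.symm ht1
      have hu' : e' * u ≡ 1 [MOD t'] := by rw [Nat.ModEq, hu, Nat.mod_eq_of_lt ht1]
      obtain ⟨k, rfl⟩ := Nat.exists_eq_add_of_lt ht'
      refine ⟨u * ((0 + k) * n'), (Nat.modEq_zero_iff_dvd).1 ?_⟩
      calc n' + u * ((0 + k) * n') * e' = n' + e' * u * (k * n') := by ring
        _ ≡ n' + 1 * (k * n') [MOD _] := (hu'.mul_right _).add_left _
        _ = (0 + k + 1) * n' := by ring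
        _ ≡ 0 [MOD _] := Nat.modEq_zero_iff_dvd.2 (dvd_mul_right _ _)
    rw [show g / (t' * c) * c = g / t' by
      obtain ⟨k, rfl⟩ := htg
      rw [Nat.mul_div_cancel_left _ ht, mul_assoc, Nat.mul_div_cancel_left _ ht', mul_comm],
      ← card_filter_modEq_Icc_one ht' (dvd_of_mul_right_dvd htg) v]
    congr 1
    refine filter_congr fun l _ => ?_
    rw [show c * n' + l * (e' * c) = (n' + l * e') * c by ring, Nat.mul_dvd_mul_iff_right hc]
    rw [← Nat.modEq_zero_iff_dvd] at hv ⊢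
    constructor
    · intro h
      exact Nat.ModEq.cancel_right_of_coprime hco (Nat.ModEq.add_left_cancel' n' (h.trans hv.symm))
    · intro h
      exact ((h.mul_right e').add_left n').trans hv
  · rw [mul_zero, card_eq_zero, filter_eq_empty_iff]
    intro l _ hl
    exact h ((Nat.dvd_add_left ((Nat.gcd_dvd_right t e).mul_left l)).1
      ((Nat.gcd_dvd_left t e).trans hl))

lemma gcd_eq_sum_totient {g : ℕ} (hg : g ≠ 0) (x : ℕ) :
    Nat.gcd g x = ∑ t ∈ g.divisors, if t ∣ x then t.totient else 0 := by
  rw [← sum_filter, ← Nat.sum_totient (Nat.gcd g x)]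
  refine sum_congr ?_ fun _ _ => rfl
  ext t
  simp [Nat.dvd_gcd_iff, hg]


/-- The totient expansion of `∑ l ∈ Icc 1 g, gcd g (n + l * (d / g))` with `g = gcd d m`. -/
def totientExpansion (d m n : ℕ) : ℕ :=
  ∑ t ∈ (Nat.gcd d m).divisors, t.totient * (Nat.gcd d m / t *
    if Nat.gcd t (d / Nat.gcd d m) ∣ n then Nat.gcd t (d / Nat.gcd d m) else 0)

lemma sum_gcd_eq_totientExpansion {d m : ℕ} (hm : 0 < m) (n : ℕ) :
    ∑ l ∈ Icc 1 (Nat.gcd d m), Nat.gcd (Nat.gcd d m) (n + l * (d / Nat.gcd d m)) =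
      totientExpansion d m n := by
  have hg : Nat.gcd d m ≠ 0 := (Nat.gcd_pos_of_pos_right d hm).ne'
  simp_rw [gcd_eq_sum_totient hg]
  rw [sum_comm, totientExpansion]
  refine sum_congr rfl fun t ht => ?_
  rw [← sum_filter, sum_const, smul_eq_mul, mul_comm,
    card_filter_dvd_add_mul (Nat.pos_of_mem_divisors ht) (Nat.dvd_of_mem_divisors ht)]

lemma totientExpansion_mul {M N d₁ d₂ m₁ m₂ : ℕ} (h : M.Coprime N) (hd₁ : d₁ ∣ M) (hm₁ : m₁ ∣ M)
    (hd₂ : d₂ ∣ N) (hm₂ : m₂ ∣ N) (n : ℕ) :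
    totientExpansion (d₁ * d₂) (m₁ * m₂) n =
      totientExpansion d₁ m₁ n * totientExpansion d₂ m₂ n := by
  have cop {a b : ℕ} (ha : a ∣ M) (hb : b ∣ N) : a.Coprime b := h.of_dvd ha hb
  have hg₁ : Nat.gcd d₁ m₁ ∣ M := (Nat.gcd_dvd_left _ _).trans hd₁
  have hg₂ : Nat.gcd d₂ m₂ ∣ N := (Nat.gcd_dvd_left _ _).trans hd₂
  have he₁ : d₁ / Nat.gcd d₁ m₁ ∣ M := (Nat.div_dvd_of_dvd (Nat.gcd_dvd_left _ _)).trans hd₁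
  have he₂ : d₂ / Nat.gcd d₂ m₂ ∣ N := (Nat.div_dvd_of_dvd (Nat.gcd_dvd_left _ _)).trans hd₂
  have hg : Nat.gcd (d₁ * d₂) (m₁ * m₂) = Nat.gcd d₁ m₁ * Nat.gcd d₂ m₂ :=
    gcd_mul_mul_of_coprime (cop hd₁ hm₂) (cop hm₁ hd₂).symm (cop hm₁ hm₂)
  simp only [totientExpansion, hg]
  rw [sum_divisors_mul_of_coprime (cop hg₁ hg₂), sum_mul_sum,
    ← Nat.div_mul_div_comm (Nat.gcd_dvd_left _ _) (Nat.gcd_dvd_left _ _)]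
  refine sum_congr rfl fun x hx => sum_congr rfl fun y hy => ?_
  have hx' := Nat.dvd_of_mem_divisors hx
  have hy' := Nat.dvd_of_mem_divisors hy
  have hxM := hx'.trans hg₁
  have hyN := hy'.trans hg₂
  rw [gcd_mul_mul_of_coprime (cop hxM he₂) (cop he₁ hyN).symm (cop he₁ he₂),
    Nat.totient_mul (cop hxM hyN), ← Nat.div_mul_div_comm hx' hy']
  have hdvd : Nat.gcd x (d₁ / Nat.gcd d₁ m₁) * Nat.gcd y (d₂ / Nat.gcd d₂ m₂) ∣ n ↔
      Nat.gcd x (d₁ / Nat.gcd d₁ m₁) ∣ n ∧ Nat.gcd y (d₂ / Nat.gcd d₂ m₂) ∣ n :=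
    ⟨fun h => ⟨dvd_of_mul_right_dvd h, dvd_of_mul_left_dvd h⟩, fun h =>
      (cop ((Nat.gcd_dvd_left _ _).trans hxM)
        ((Nat.gcd_dvd_left _ _).trans hyN)).mul_dvd_of_dvd_of_dvd h.1 h.2⟩
  simp only [hdvd]
  by_cases h₁ : Nat.gcd x (d₁ / Nat.gcd d₁ m₁) ∣ n
  · by_cases h₂ : Nat.gcd y (d₂ / Nat.gcd d₂ m₂) ∣ n
    · simp only [h₁, h₂, and_self, if_true]
      ring
    · simp [h₂]
  · simp [h₁]

lemma gcd_chain_mul {M N d₁ d₂ m₁ m₂ : ℕ} (h : M.Coprime N) (hd₁ : d₁ ∣ M) (hm₁ : m₁ ∣ M)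
    (hd₂ : d₂ ∣ N) (hm₂ : m₂ ∣ N) (n : ℕ) :
    Nat.gcd (d₁ * d₂) (Nat.gcd (m₁ * m₂)
        (Nat.gcd (M * N / (d₁ * d₂)) (Nat.gcd (M * N / (m₁ * m₂)) n))) =
      Nat.gcd d₁ (Nat.gcd m₁ (Nat.gcd (M / d₁) (Nat.gcd (M / m₁) n))) *
        Nat.gcd d₂ (Nat.gcd m₂ (Nat.gcd (N / d₂) (Nat.gcd (N / m₂) n))) := by
  have cop {a b : ℕ} (ha : a ∣ M) (hb : b ∣ N) : a.Coprime b := h.of_dvd ha hb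
  have cop' {a b c d : ℕ} (ha : a ∣ M) (hb : b ∣ N) (hc : c ∣ M) (hd : d ∣ N) :
      Nat.gcd (a * b) (c * d) = Nat.gcd a c * Nat.gcd b d :=
    gcd_mul_mul_of_coprime (cop ha hd) (cop hc hb).symm (cop hc hd)
  have gl {a b K : ℕ} (ha : a ∣ K) : Nat.gcd a b ∣ K := (Nat.gcd_dvd_left a b).trans ha
  have q₁ := Nat.div_dvd_of_dvd hd₁
  have q₂ := Nat.div_dvd_of_dvd hd₂
  have r₁ := Nat.div_dvd_of_dvd hm₁
  have r₂ := Nat.div_dvd_of_dvd hm₂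
  rw [← Nat.div_mul_div_comm hd₁ hd₂, ← Nat.div_mul_div_comm hm₁ hm₂,
    Nat.gcd_comm (M / m₁ * (N / m₂)) n, (cop r₁ r₂).gcd_mul, Nat.gcd_comm n, Nat.gcd_comm n,
    cop' q₁ q₂ (gl r₁) (gl r₂), cop' hm₁ hm₂ (gl q₁) (gl q₂), cop' hd₁ hd₂ (gl hm₁) (gl hm₂)]

lemma gcd_prime_pow_eq_sum_totient {p : ℕ} (hp : p.Prime) (r n : ℕ) :
    Nat.gcd (p ^ r) n =
      ∑ k ∈ range (r + 1), if p ^ k ∣ n then (p ^ k).totient else 0 := by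
  rw [gcd_eq_sum_totient (pow_pos hp.pos r).ne', Nat.sum_divisors_prime_pow hp]

lemma gcd_pow_pow (p i j : ℕ) : Nat.gcd (p ^ i) (p ^ j) = p ^ min i j := by
  rcases le_total i j with h | h
  · rw [min_eq_left h, Nat.gcd_eq_left (pow_dvd_pow p h)]
  · rw [min_eq_right h, Nat.gcd_eq_right (pow_dvd_pow p h)]

lemma sum_totient_mul_prime_pow {p : ℕ} (hp : p.Prime) (b : ℕ) :
    ∑ i ∈ range (b + 2), (p ^ i).totient * p ^ (b + 1 - i) =
      p ^ (b + 1) + (b + 1) * (p ^ (b + 1)).totient := by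
  rw [sum_range_succ', add_comm]
  congr 1
  · simp
  · rw [sum_congr rfl (g := fun _ => (p ^ (b + 1)).totient), sum_const, card_range, smul_eq_mul]
    intro i hi
    have hi' : i ≤ b := by simpa [Nat.lt_succ_iff] using hi
    rw [Nat.totient_prime_pow_succ hp, Nat.totient_prime_pow_succ hp,
      show b + 1 - (i + 1) = b - i by omega, mul_right_comm, ← pow_add, Nat.add_sub_cancel' hi']

lemma sum_sum_totient_mul_prime_pow {p : ℕ} (hp : p.Prime) (a : ℕ) :
    ∑ b ∈ range (a + 1), ∑ i ∈ range (b + 1), (p ^ i).totient * p ^ (b - i) =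
      p ^ a * (a + 1) := by
  induction a with
  | zero => simp
  | succ a ih =>
    rw [sum_range_succ, ih, sum_totient_mul_prime_pow hp, Nat.totient_prime_pow_succ hp]
    obtain ⟨q, rfl⟩ := Nat.exists_eq_add_of_le hp.one_le
    rw [Nat.add_sub_cancel_left]
    ring

lemma totientExpansion_prime_pow_of_le {p : ℕ} (hp : p.Prime) {a b : ℕ} (h : b ≤ a) (n : ℕ) :
    totientExpansion (p ^ b) (p ^ a) n =
      ∑ i ∈ range (b + 1), (p ^ i).totient * p ^ (b - i) := by
  rw [totientExpansion, gcd_pow_pow, min_eq_left h, Nat.div_self (pow_pos hp.pos b),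
    Nat.sum_divisors_prime_pow hp]
  refine sum_congr rfl fun i hi => ?_
  have hi' : i ≤ b := by simpa [Nat.lt_succ_iff] using hi
  simp [Nat.pow_div hi' hp.pos]

lemma totientExpansion_prime_pow_add {p : ℕ} (hp : p.Prime) (a j n : ℕ) :
    totientExpansion (p ^ (a + j + 1)) (p ^ a) n =
      p ^ a * ((∑ k ∈ range (min a (j + 1) + 1), if p ^ k ∣ n then (p ^ k).totient else 0) +
        (a - (j + 1)) * if p ^ (j + 1) ∣ n then (p ^ (j + 1)).totient else 0) := by
  have term : totientExpansion (p ^ (a + j + 1)) (p ^ a) n = ∑ i ∈ range (a + 1),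
      (p ^ i).totient * (p ^ (a - i) *
        if p ^ min i (j + 1) ∣ n then p ^ min i (j + 1) else 0) := by
    rw [add_assoc, totientExpansion, gcd_pow_pow, min_eq_right (Nat.le_add_right _ _),
      Nat.pow_div (Nat.le_add_right _ _) hp.pos, Nat.add_sub_cancel_left,
      Nat.sum_divisors_prime_pow hp]
    refine sum_congr rfl fun i hi => ?_
    have hi' : i ≤ a := by simpa [Nat.lt_succ_iff] using hi
    rw [gcd_pow_pow, Nat.pow_div hi' hp.pos]
  have low {i : ℕ} (hi : i ≤ a) (hij : i ≤ j + 1) :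
      (p ^ i).totient * (p ^ (a - i) * if p ^ min i (j + 1) ∣ n then p ^ min i (j + 1) else 0) =
        p ^ a * if p ^ i ∣ n then (p ^ i).totient else 0 := by
    rw [min_eq_left hij]
    split_ifs
    · rw [← pow_add, Nat.sub_add_cancel hi, mul_comm]
    · simp
  have high {i : ℕ} (hi : j + 2 + i ≤ a) :
      (p ^ (j + 2 + i)).totient * (p ^ (a - (j + 2 + i)) *
          if p ^ min (j + 2 + i) (j + 1) ∣ n then p ^ min (j + 2 + i) (j + 1) else 0) =
        p ^ a * if p ^ (j + 1) ∣ n then (p ^ (j + 1)).totient else 0 := by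
    rw [min_eq_right (by omega)]
    split_ifs
    · obtain ⟨c, rfl⟩ := Nat.exists_eq_add_of_le hi
      rw [show j + 2 + i = j + 1 + i + 1 by ring, Nat.totient_prime_pow_succ hp,
        Nat.totient_prime_pow_succ hp, Nat.add_sub_cancel_left]
      ring
    · simp
  rw [term]
  rcases le_total a (j + 1) with h | h
  · rw [min_eq_left h, Nat.sub_eq_zero_of_le h, zero_mul, add_zero, mul_sum]
    refine sum_congr rfl fun i hi => ?_
    have hi' : i ≤ a := by simpa [Nat.lt_succ_iff] using hi
    exact low hi' (hi'.trans h)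
  · obtain ⟨c, rfl⟩ := Nat.exists_eq_add_of_le h
    rw [min_eq_right h, Nat.add_sub_cancel_left, mul_add, mul_sum,
      show j + 1 + c + 1 = j + 2 + c by ring, sum_range_add]
    congr 1
    · refine sum_congr rfl fun i hi => ?_
      have := mem_range.1 hi
      exact low (by omega) (by omega)
    · rw [sum_congr rfl fun i hi => high (by have := mem_range.1 hi; omega), sum_const, card_range,
        smul_eq_mul]
      ring

lemma sum_gcd_chain_prime_pow {p : ℕ} (hp : p.Prime) (a j n : ℕ) :
    ∑ b ∈ range (a + j + 1), Nat.gcd (p ^ b) (Nat.gcd (p ^ a)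
        (Nat.gcd (p ^ (a + j) / p ^ b) (Nat.gcd (p ^ (a + j) / p ^ a) n))) =
      ∑ k ∈ range (min a j + 1),
        (a + j + 1 - 2 * k) * if p ^ k ∣ n then (p ^ k).totient else 0 := by
  have term {b : ℕ} (hb : b ∈ range (a + j + 1)) :
      Nat.gcd (p ^ b) (Nat.gcd (p ^ a)
        (Nat.gcd (p ^ (a + j) / p ^ b) (Nat.gcd (p ^ (a + j) / p ^ a) n))) =
      ∑ k ∈ range (min (min (min b a) (a + j - b)) j + 1),
        if p ^ k ∣ n then (p ^ k).totient else 0 := by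
    have hb' : b ≤ a + j := by simpa [Nat.lt_succ_iff] using hb
    rw [Nat.pow_div hb' hp.pos, Nat.pow_div (Nat.le_add_right _ _) hp.pos,
      Nat.add_sub_cancel_left, ← Nat.gcd_assoc, ← Nat.gcd_assoc, ← Nat.gcd_assoc,
      gcd_pow_pow, gcd_pow_pow, gcd_pow_pow, gcd_prime_pow_eq_sum_totient hp]
  rw [sum_congr rfl fun b hb => term hb,
    sum_comm' (t' := range (min a j + 1)) (s' := fun k => Icc k (a + j - k))]
  · refine sum_congr rfl fun k hk => ?_
    have := mem_range.1 hk
    rw [sum_const, smul_eq_mul, Nat.card_Icc, show a + j - k + 1 - k = a + j + 1 - 2 * k by omega]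
  · intro b k
    simp only [mem_range, mem_Icc]
    omega

lemma sum_totientExpansion_prime_pow {p : ℕ} (hp : p.Prime) (a j n : ℕ) :
    ∑ b ∈ range (a + j + 1), totientExpansion (p ^ b) (p ^ a) n =
      p ^ a * ∑ k ∈ range (min a j + 1),
        (a + j + 1 - 2 * k) * if p ^ k ∣ n then (p ^ k).totient else 0 := by
  induction j with
  | zero =>
    rw [add_zero, sum_congr rfl fun b hb => totientExpansion_prime_pow_of_le hp
      (Nat.lt_succ_iff.1 (mem_range.1 hb)) n, sum_sum_totient_mul_prime_pow hp]
    simp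
  | succ j ih =>
    rw [← add_assoc a j 1, sum_range_succ, ih, totientExpansion_prime_pow_add hp, ← mul_add]
    congr 1
    have step {s : ℕ} (hs : 2 * s ≤ a + j + 2) :
        (∑ k ∈ range s, (a + j + 1 - 2 * k) * if p ^ k ∣ n then (p ^ k).totient else 0) +
          ∑ k ∈ range s, (if p ^ k ∣ n then (p ^ k).totient else 0) =
        ∑ k ∈ range s, (a + j + 1 + 1 - 2 * k) *
          if p ^ k ∣ n then (p ^ k).totient else 0 := by
      rw [← sum_add_distrib]
      refine sum_congr rfl fun k hk => ?_
      have := mem_range.1 hk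
      rw [show a + j + 1 + 1 - 2 * k = a + j + 1 - 2 * k + 1 by omega, add_one_mul]
    rcases Nat.lt_or_ge j a with h | h
    · rw [min_eq_right h.le, min_eq_right (Nat.succ_le_of_lt h), sum_range_succ _ (j + 1),
        sum_range_succ _ (j + 1), ← step (by omega),
        show a + j + 1 + 1 - 2 * (j + 1) = a - (j + 1) + 1 by omega]
      ring
    · rw [min_eq_left h, min_eq_left (h.trans (Nat.le_succ j)), ← step (by omega),
        Nat.sub_eq_zero_of_le (h.trans (Nat.le_succ j)), zero_mul, add_zero]

lemma sum_totientExpansion {N m : ℕ} (hN : 0 < N) (hmN : m ∣ N) (n : ℕ) :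
    ∑ d ∈ N.divisors, totientExpansion d m n =
      m * ∑ d ∈ N.divisors,
        Nat.gcd d (Nat.gcd m (Nat.gcd (N / d) (Nat.gcd (N / m) n))) := by
  induction N using Nat.recOnPrimeCoprime generalizing m with
  | zero => exact absurd hN (lt_irrefl 0)
  | prime_pow p A hp =>
    obtain ⟨a, ha, rfl⟩ := (Nat.dvd_prime_pow hp).1 hmN
    obtain ⟨j, rfl⟩ := Nat.exists_eq_add_of_le ha
    rw [Nat.sum_divisors_prime_pow hp, Nat.sum_divisors_prime_pow hp,
      sum_totientExpansion_prime_pow hp, sum_gcd_chain_prime_pow hp]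
  | coprime M K hM hK hMK ihM ihK =>
    obtain ⟨m₁, m₂, hm₁, hm₂, rfl⟩ := Nat.dvd_mul.1 hmN
    have hL : ∀ x ∈ M.divisors, ∀ y ∈ K.divisors, totientExpansion (x * y) (m₁ * m₂) n =
        totientExpansion x m₁ n * totientExpansion y m₂ n := fun x hx y hy =>
      totientExpansion_mul hMK (Nat.dvd_of_mem_divisors hx) hm₁ (Nat.dvd_of_mem_divisors hy) hm₂ n
    rw [sum_divisors_mul_of_coprime hMK, sum_divisors_mul_of_coprime hMK,
      sum_congr rfl fun x hx => sum_congr rfl (hL x hx),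
      sum_congr rfl fun x hx => sum_congr rfl fun y hy => gcd_chain_mul hMK
        (Nat.dvd_of_mem_divisors hx) hm₁ (Nat.dvd_of_mem_divisors hy) hm₂ n,
      ← sum_mul_sum, ← sum_mul_sum, ihM (by omega) hm₁, ihK (by omega) hm₂]
    ring

theorem semiclassical_index_regrouped (N m n : ℕ) (hN : 0 < N) (hm : 0 < m) (hmN : m ∣ N) :
    N / m * ∑ d ∈ N.divisors, ∑ l ∈ Finset.Icc 1 (Nat.gcd d m),
        Nat.gcd (Nat.gcd d m) (n + l * (d / Nat.gcd d m))
      = N * ∑ d ∈ N.divisors,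
          Nat.gcd d (Nat.gcd m (Nat.gcd (N / d) (Nat.gcd (N / m) n))) := by
  simp_rw [sum_gcd_eq_totientExpansion hm]
  rw [sum_totientExpansion hN hmN, ← mul_assoc, Nat.div_mul_cancel hmN]
end

section
/- Let N be a positive integer, let m be a positive divisor of N, and let n be a natural number. Then ∑_{d | N} ∑_{t=0}^{d-1} gcd( (N/m)·d, (N/d)·m, (N/m)·t + (N/d)·n ) = (N/m) · ∑_{d | N} ∑_{l=1}^{gcd(d,m)} gcd( gcd(d,m), n + l·(d/gcd(d,m)) ), where both outer sums run over the positive divisors d of N. -/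
theorem Nat.Coprime.exists_add_mul_coprime {a b : ℕ} (h : a.Coprime b) (hb : 0 < b) {g : ℕ}
    (hg : 0 < g) : ∃ s, (a + b * s).Coprime g := by
  have : NeZero (b * g) := ⟨by positivity⟩
  obtain ⟨u, hu⟩ := ZMod.unitsMap_surjective (Dvd.intro g rfl : b ∣ b * g) (ZMod.unitOfCoprime a h)
  have hcop := ZMod.val_coe_unit_coprime u
  have hmod : a ≡ (u : ZMod (b * g)).val + (b * g) * a [MOD b] := by
    rw [← ZMod.natCast_eq_natCast_iff]
    have := congrArg Units.val hu
    rw [ZMod.unitsMap_val, ZMod.coe_unitOfCoprime] at this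
    simp [← this, ZMod.natCast_val]
  have hle : a ≤ (u : ZMod (b * g)).val + (b * g) * a :=
    (Nat.le_mul_of_pos_left a (by positivity)).trans (Nat.le_add_left _ _)
  obtain ⟨s, hs⟩ := (Nat.modEq_iff_dvd' hle).mp hmod
  refine ⟨s, ?_⟩
  rw [← hs, Nat.add_sub_cancel' hle]
  exact ((Nat.coprime_add_mul_left_left _ _ _).mpr hcop).coprime_dvd_right (Dvd.intro_left b rfl)

theorem ZMod.gcd_val_natCast (g a : ℕ) : Nat.gcd g (a : ZMod g).val = Nat.gcd g a := by
  rw [ZMod.val_natCast, Nat.gcd_comm, ← Nat.gcd_rec]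

theorem ZMod.sum_range_natCast {M : Type*} [AddCommMonoid M] (g : ℕ) [NeZero g] (F : ZMod g → M) :
    ∑ t ∈ Finset.range g, F (t : ZMod g) = ∑ x : ZMod g, F x := by
  rw [Finset.sum_range, ← Equiv.sum_comp (ZMod.finEquiv g).toEquiv]
  refine Finset.sum_congr rfl fun i _ => congrArg F ?_
  cases g with
  | zero => exact i.elim0
  | succ k => exact Fin.cast_val_eq_self i

theorem Finset.sum_range_mul_of_periodic {M : Type*} [AddCommMonoid M] {f : ℕ → M} {g : ℕ}
    (hf : Function.Periodic f g) (k : ℕ) :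
    ∑ t ∈ Finset.range (g * k), f t = k • ∑ t ∈ Finset.range g, f t := by
  induction k with
  | zero => simp
  | succ k ih =>
    rw [Nat.mul_succ, Finset.sum_range_add, ih, succ_nsmul]
    congr 1
    refine Finset.sum_congr rfl fun x _ => ?_
    rw [add_comm, mul_comm]
    exact hf.nat_mul k x

/-- Multiplying the offset of an arithmetic progression of step `b` by some `a` coprime to `b`
does not change the sum of the gcds of its first `g` terms with `g`. -/
theorem Nat.Coprime.sum_gcd_add_mul {a b : ℕ} (h : a.Coprime b) (hb : 0 < b) {g : ℕ} (hg : 0 < g)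
    (n : ℕ) :
    ∑ t ∈ Finset.range g, Nat.gcd g (b * t + a * n) =
      ∑ l ∈ Finset.Icc 1 g, Nat.gcd g (n + l * b) := by
  have : NeZero g := ⟨hg.ne'⟩
  obtain ⟨s, hs⟩ := h.exists_add_mul_coprime hb hg
  let F : ZMod g → ℕ := fun x => Nat.gcd g (b * x + a * n : ZMod g).val
  have hF (t : ℕ) : F t = Nat.gcd g (b * t + a * n) := by
    rw [← ZMod.gcd_val_natCast g (b * t + a * n)]
    push_cast
    rfl
  let e : ZMod g ≃ ZMod g :=
    ((Equiv.addRight 1).trans (ZMod.unitOfCoprime _ hs).mulLeft).trans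
      (Equiv.addLeft (s * n : ZMod g))
  have he (l : ℕ) : F (e l) = Nat.gcd g (n + (1 + l) * b) := by
    have : e l = ((s * n + (a + b * s) * (l + 1) : ℕ) : ZMod g) := by simp [e]
    rw [this, hF, ← Nat.Coprime.gcd_mul_left_cancel_right (n + (1 + l) * b) hs]
    congr 1
    ring
  calc ∑ t ∈ Finset.range g, Nat.gcd g (b * t + a * n)
      = ∑ x, F x := by simp_rw [← hF, ZMod.sum_range_natCast]
    _ = ∑ l ∈ Finset.range g, F (e l) := by
        rw [ZMod.sum_range_natCast g fun x => F (e x), Equiv.sum_comp e F]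
    _ = ∑ l ∈ Finset.Icc 1 g, Nat.gcd g (n + l * b) := by
        simp_rw [he]
        rw [← Finset.Ico_add_one_right_eq_Icc, Finset.sum_Ico_eq_sum_range, Nat.add_sub_cancel]

/-- The lattice count and the semiclassical index agree divisor by divisor: with
`d = g * b`, `m = g * a`, `N / m = b * c` and `N / d = a * c`, where `a` and `b` are coprime. -/
theorem Nat.Coprime.sum_gcd_lattice {a b : ℕ} (h : a.Coprime b) (hb : 0 < b) {g : ℕ} (hg : 0 < g)
    (c n : ℕ) :
    ∑ t ∈ Finset.range (g * b),
        Nat.gcd (b * c * (g * b)) (Nat.gcd (a * c * (g * a)) (b * c * t + a * c * n)) =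
      b * c * ∑ l ∈ Finset.Icc 1 g, Nat.gcd g (n + l * b) := by
  have hterm (t : ℕ) :
      Nat.gcd (b * c * (g * b)) (Nat.gcd (a * c * (g * a)) (b * c * t + a * c * n)) =
        c * Nat.gcd g (b * t + a * n) := by
    have hgcd : Nat.gcd (b * c * (g * b)) (a * c * (g * a)) = c * g := by
      rw [show b * c * (g * b) = c * g * b ^ 2 by ring, show a * c * (g * a) = c * g * a ^ 2 by ring,
        Nat.gcd_mul_left, (h.symm.pow 2 2).gcd_eq_one, mul_one]
    rw [← Nat.gcd_assoc, hgcd, show b * c * t + a * c * n = c * (b * t + a * n) by ring,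
      Nat.gcd_mul_left]
  have hper : Function.Periodic (fun t => Nat.gcd g (b * t + a * n)) g := fun t => by
    simp only [show b * (t + g) + a * n = b * t + a * n + b * g by ring, Nat.gcd_add_mul_right_right]
  simp_rw [hterm]
  rw [← Finset.mul_sum, Finset.sum_range_mul_of_periodic hper, h.sum_gcd_add_mul hb hg, smul_eq_mul]
  ring

theorem lattice_count_eq_semiclassical_index (N m n : ℕ) (hN : 0 < N) (hm : 0 < m)
    (hmN : m ∣ N) :
    ∑ d ∈ N.divisors, ∑ t ∈ Finset.range d,
        Nat.gcd (N / m * d) (Nat.gcd (N / d * m) (N / m * t + N / d * n))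
      = N / m * ∑ d ∈ N.divisors, ∑ l ∈ Finset.Icc 1 (Nat.gcd d m),
          Nat.gcd (Nat.gcd d m) (n + l * (d / Nat.gcd d m)) := by
  rw [Finset.mul_sum]
  refine Finset.sum_congr rfl fun d hd => ?_
  have hdN := Nat.dvd_of_mem_divisors hd
  have hd0 : 0 < d := Nat.pos_of_mem_divisors hd
  obtain ⟨g, b, a, hg, hab, hdb, hma⟩ :=
    Nat.exists_coprime' (m := d) (n := m) (Nat.gcd_pos_of_pos_left m hd0)
  obtain rfl : d = g * b := by rw [hdb, mul_comm]
  obtain rfl : m = g * a := by rw [hma, mul_comm]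
  have hb : 0 < b := Nat.pos_of_mul_pos_left hd0
  have hgcd : Nat.gcd (g * b) (g * a) = g := by rw [Nat.gcd_mul_left, hab.gcd_eq_one, mul_one]
  obtain ⟨c, rfl⟩ : g * (b * a) ∣ N := by
    have := Nat.lcm_dvd hdN hmN
    rwa [Nat.lcm_mul_left, hab.lcm_eq_mul] at this
  have hNm : g * (b * a) * c / (g * a) = b * c :=
    Nat.div_eq_of_eq_mul_left hm (by ring)
  have hNd : g * (b * a) * c / (g * b) = a * c :=
    Nat.div_eq_of_eq_mul_left hd0 (by ring)
  rw [hgcd, hNm, hNd, Nat.mul_div_cancel_left b hg]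
  exact hab.symm.sum_gcd_lattice hb hg c n
end

section
/- Let N be a positive integer, let m be a positive divisor of N, and let n be a natural number. Then I(N, m, n + N/m) = I(N, m, n), where I(N,m,n) := (N/m)·∑_{d|N} ∑_{l=1}^{gcd(d,m)} gcd( gcd(d,m), n + l·(d/gcd(d,m)) ) and the outer sum runs over the positive divisors d of N. (T-duality invariance of the index.) -/
/-- The semiclassical index of the `N = 1*` theory `(SU(N)/Z_m)_n` on a circle. -/
def indexN1star (N m n : ℕ) : ℕ :=
  N / m * ∑ d ∈ N.divisors, ∑ l ∈ Finset.Icc 1 (Nat.gcd d m),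
    Nat.gcd (Nat.gcd d m) (n + l * (d / Nat.gcd d m))

/-- The sum of a `g`-periodic function over a full period is invariant under translation. -/
theorem Function.Periodic.sum_Icc_add {M : Type*} [AddCommMonoid M] {f : ℕ → M} {g : ℕ}
    (hf : Function.Periodic f g) (k : ℕ) :
    ∑ l ∈ Finset.Icc 1 g, f (l + k) = ∑ l ∈ Finset.Icc 1 g, f l := by
  have range_form (h : ℕ → M) :
      ∑ l ∈ Finset.Icc 1 g, h l = ∑ i ∈ Finset.range g, h (i + 1) := by
    rw [Finset.range_eq_Ico, Finset.sum_Ico_add' h 0 g 1]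
    rfl
  induction k with
  | zero => simp
  | succ k ih =>
    rw [← ih, range_form, range_form]
    rcases g with _ | g
    · simp
    · rw [Finset.sum_range_succ, Finset.sum_range_succ']
      congr 1
      · exact Finset.sum_congr rfl fun i _ => congrArg f (by ring)
      · rw [← hf (0 + 1 + k)]
        exact congrArg f (by ring)

/-- If `d` and `m` both divide `N`, then `d / gcd d m` divides `N / m`. -/
theorem Nat.div_gcd_dvd_div {N m d : ℕ} (hdN : d ∣ N) (hmN : m ∣ N) :
    d / d.gcd m ∣ N / m := by
  refine Nat.dvd_div_of_mul_dvd ?_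
  rw [← Nat.mul_div_assoc m (Nat.gcd_dvd_left d m), mul_comm m d]
  exact Nat.lcm_dvd hdN hmN

theorem T_duality_invariance (N m n : ℕ) (hN : 0 < N) (hm : 0 < m) (hmN : m ∣ N) :
    indexN1star N m (n + N / m) = indexN1star N m n := by
  unfold indexN1star
  congr 1
  refine Finset.sum_congr rfl fun d hd => ?_
  obtain ⟨k, hk⟩ := Nat.div_gcd_dvd_div (Nat.dvd_of_mem_divisors hd) hmN
  have periodic : Function.Periodic
      (fun l => Nat.gcd (Nat.gcd d m) (n + l * (d / Nat.gcd d m))) (Nat.gcd d m) := fun l => by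
    simp only [add_mul, ← add_assoc, Nat.gcd_add_mul_left_right]
  rw [← periodic.sum_Icc_add k, hk]
  exact Finset.sum_congr rfl fun l _ => congrArg _ (by ring)
end

section
/- Let N be a positive integer, let m and m' be positive divisors of N, and let n, n' be natural numbers such that gcd(m, n) = N/m' and gcd(m', n') = N/m. Then I(N, m, n) = I(N, m', n'), where I(N,m,n) := (N/m)·∑_{d|N} ∑_{l=1}^{gcd(d,m)} gcd( gcd(d,m), n + l·(d/gcd(d,m)) ) and the outer sum runs over the positive divisors d of N. (S-duality invariance of the index.) -/
/-- The number of solutions `l` modulo `g` of the congruence `l * b + c ≡ 0`. -/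
lemma card_filter_dvd_mul_add (g b c : ℕ) (hg : 0 < g) :
    ((Finset.range g).filter (fun l => g ∣ l * b + c)).card
      = if Nat.gcd g b ∣ c then Nat.gcd g b else 0 := by
  have hh : 0 < Nat.gcd g b := Nat.gcd_pos_of_pos_left b hg
  split_ifs with h
  · obtain ⟨l₀, hl₀⟩ : ∃ l₀ : ℕ, g ∣ l₀ * b + c := by
      have : NeZero g := ⟨hg.ne'⟩
      obtain ⟨w, hw⟩ := h
      have hbez := congrArg (Int.cast : ℤ → ZMod g) (Nat.gcd_eq_gcd_ab g b)
      push_cast at hbez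
      refine ⟨(-(Nat.gcdB g b : ZMod g) * w).val, ?_⟩
      rw [← ZMod.natCast_eq_zero_iff]
      push_cast
      rw [ZMod.natCast_zmod_val, hw]
      push_cast
      rw [hbez, ZMod.natCast_self]
      ring
    have key : ∀ l, g ∣ l * b + c ↔ l ≡ l₀ [MOD g / Nat.gcd g b] := by
      intro l
      constructor
      · intro hl
        have h1 : l * b + c ≡ l₀ * b + c [MOD g] :=
          ((Nat.modEq_zero_iff_dvd).2 hl).trans ((Nat.modEq_zero_iff_dvd).2 hl₀).symm
        exact Nat.ModEq.cancel_right_div_gcd hg (Nat.ModEq.add_right_cancel' c h1)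
      · intro hl
        have h2 : l * b ≡ l₀ * b [MOD g] := by
          obtain ⟨b', hb'⟩ := Nat.gcd_dvd_right g b
          have h3 := hl.mul_right' (Nat.gcd g b)
          rw [Nat.div_mul_cancel (Nat.gcd_dvd_left g b)] at h3
          have h4 := h3.mul_right b'
          rwa [mul_assoc, mul_assoc, ← hb'] at h4
        exact (Nat.modEq_zero_iff_dvd).1
          ((h2.add_right c).trans ((Nat.modEq_zero_iff_dvd).2 hl₀))
    have hr : 0 < g / Nat.gcd g b := Nat.div_pos (Nat.gcd_le_left b hg) hh
    simp only [key]
    rw [← Nat.count_eq_card_filter_range, Nat.count_modEq_card _ hr,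
      Nat.mod_eq_zero_of_dvd (Nat.div_dvd_of_dvd (Nat.gcd_dvd_left g b)),
      Nat.div_div_self (Nat.gcd_dvd_left g b) hg.ne']
    simp
  · rw [Finset.card_eq_zero, Finset.filter_eq_empty_iff]
    intro l _ hl
    exact h ((Nat.dvd_add_right ((Nat.gcd_dvd_right g b).mul_left l)).1
      ((Nat.gcd_dvd_left g b).trans hl))

lemma sum_range_gcd_add_mul (g e n : ℕ) (hg : 0 < g) :
    ∑ l ∈ Finset.range g, Nat.gcd g (n + l * e)
      = ∑ z ∈ Finset.range g, if Nat.gcd g (z * e) ∣ z * n then Nat.gcd g (z * e) else 0 := by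
  have h1 : ∀ x, Nat.gcd g x = ∑ z ∈ Finset.range g, if g ∣ z * x then 1 else 0 := by
    intro x
    rw [← Finset.card_filter]
    simpa using (card_filter_dvd_mul_add g x 0 hg).symm
  rw [Finset.sum_congr rfl (fun l _ => h1 (n + l * e)), Finset.sum_comm]
  refine Finset.sum_congr rfl fun z _ => ?_
  rw [← card_filter_dvd_mul_add g (z * e) (z * n) hg, Finset.card_filter]
  refine Finset.sum_congr rfl fun l _ => ?_
  rw [show z * (n + l * e) = l * (z * e) + z * n by ring]

lemma sum_Icc_eq_sum_range (f : ℕ → ℕ) (g : ℕ) (h : f g = f 0) :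
    ∑ l ∈ Finset.Icc 1 g, f l = ∑ l ∈ Finset.range g, f l := by
  have h1 := Finset.sum_range_succ f g
  rw [Finset.sum_range_succ', h, add_left_inj] at h1
  rw [← h1, Finset.range_eq_Ico, Finset.sum_Ico_add' f 0 g 1]
  rfl

lemma sum_range_gcd_eq_sum_filter (d m : ℕ) (hm : 0 < m) (H : ℕ → ℕ) :
    ∑ z ∈ Finset.range (Nat.gcd d m), H (z * (m / Nat.gcd d m))
      = ∑ a ∈ (Finset.range m).filter (fun a => m ∣ d * a), H a := by
  have hg : 0 < Nat.gcd d m := Nat.gcd_pos_of_pos_right d hm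
  obtain ⟨e, m₁, hcop, hd, hm₁⟩ := Nat.exists_coprime d m
  generalize Nat.gcd d m = g at *
  subst hd hm₁
  have hm₁ : 0 < m₁ := Nat.pos_of_mul_pos_right hm
  rw [Nat.mul_div_cancel _ hg]
  have hdvd : ∀ a, m₁ * g ∣ e * g * a ↔ m₁ ∣ a := by
    intro a
    rw [show e * g * a = (e * a) * g by ring, Nat.mul_dvd_mul_iff_right hg]
    exact hcop.symm.dvd_mul_left
  refine Finset.sum_nbij' (fun z => z * m₁) (fun a => a / m₁) ?_ ?_ ?_ ?_ ?_
  · intro z hz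
    simp only [Finset.mem_filter, Finset.mem_range, hdvd] at hz ⊢
    exact ⟨by nlinarith, Dvd.intro_left z rfl⟩
  · intro a ha
    simp only [Finset.mem_filter, Finset.mem_range] at ha ⊢
    exact Nat.div_lt_of_lt_mul ha.1
  · intro z _
    exact Nat.mul_div_cancel _ hm₁
  · intro a ha
    simp only [Finset.mem_filter, hdvd] at ha
    exact Nat.div_mul_cancel ha.2
  · intro z _
    rfl

lemma sum_Icc_gcd_eq_sum_filter (d m n : ℕ) (hm : 0 < m) :
    ∑ l ∈ Finset.Icc 1 (Nat.gcd d m), Nat.gcd (Nat.gcd d m) (n + l * (d / Nat.gcd d m))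
      = ∑ a ∈ (Finset.range m).filter (fun a => m ∣ d * a),
        if Nat.gcd (Nat.gcd a m * d / m) m ∣ n * a
          then Nat.gcd (Nat.gcd a m * d / m) m else 0 := by
  have hg : 0 < Nat.gcd d m := Nat.gcd_pos_of_pos_right d hm
  rw [sum_Icc_eq_sum_range _ _ (by simp), sum_range_gcd_add_mul _ _ _ hg,
    ← sum_range_gcd_eq_sum_filter d m hm
      (fun a => if Nat.gcd (Nat.gcd a m * d / m) m ∣ n * a
          then Nat.gcd (Nat.gcd a m * d / m) m else 0)]
  refine Finset.sum_congr rfl fun z _ => ?_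
  obtain ⟨e, m₁, hcop, hd, hm₁⟩ := Nat.exists_coprime d m
  generalize Nat.gcd d m = g at *
  subst hd hm₁
  have hm₁ : 0 < m₁ := Nat.pos_of_mul_pos_right hm
  rw [Nat.mul_div_cancel _ hg, Nat.mul_div_cancel _ hg]
  have hs : Nat.gcd (z * m₁) (m₁ * g) * (e * g) / (m₁ * g) = Nat.gcd z g * e := by
    rw [mul_comm m₁ g, Nat.gcd_mul_right,
      show Nat.gcd z g * m₁ * (e * g) = Nat.gcd z g * e * (g * m₁) by ring]
    exact Nat.mul_div_cancel _ (by positivity)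
  have hgcd : Nat.gcd (Nat.gcd z g * e) (m₁ * g) = Nat.gcd g (z * e) := by
    obtain ⟨z₁, v, hzv, hz, hv⟩ := Nat.exists_coprime z g
    generalize Nat.gcd z g = u at *
    subst hz hv
    rw [show m₁ * (v * u) = u * (m₁ * v) by ring, Nat.gcd_mul_left,
      Nat.Coprime.gcd_mul_left_cancel_right v hcop.symm,
      show v * u = u * v by ring, show z₁ * u * e = u * (z₁ * e) by ring, Nat.gcd_mul_left,
      Nat.Coprime.gcd_mul_left_cancel_right e hzv, Nat.gcd_comm]
  rw [hs, hgcd]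
  have hiff : Nat.gcd g (z * e) ∣ n * (z * m₁) ↔ Nat.gcd g (z * e) ∣ z * n := by
    constructor
    · intro h
      have h1 : Nat.gcd g (z * e) ∣ Nat.gcd (z * n * m₁) (z * n * e) :=
        Nat.dvd_gcd (by rwa [show z * n * m₁ = n * (z * m₁) by ring])
          (by
            rw [show z * n * e = z * e * n by ring]
            exact (Nat.gcd_dvd_right _ _).mul_right n)
      rwa [Nat.gcd_mul_left, Nat.gcd_comm m₁ e, hcop.gcd_eq_one, mul_one] at h1
    · intro h
      rw [show n * (z * m₁) = z * n * m₁ by ring]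
      exact h.mul_right m₁
  simp only [hiff]

lemma sum_divisors_filter_dvd (k m a : ℕ) (hk : 0 < k) (hm : 0 < m) (F : ℕ → ℕ) :
    ∑ d ∈ (k * m).divisors.filter (fun d => m ∣ d * a), F (Nat.gcd a m * d / m)
      = ∑ s ∈ (k * m).divisors.filter (fun s => s ∣ k * a), F s := by
  have hu : 0 < Nat.gcd a m := Nat.gcd_pos_of_pos_right a hm
  obtain ⟨a₁, w, hcop, ha, hw⟩ := Nat.exists_coprime a m
  generalize Nat.gcd a m = u at *
  subst ha hw
  have hw : 0 < w := Nat.pos_of_mul_pos_right hm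
  have hdvd : ∀ d, w * u ∣ d * (a₁ * u) ↔ w ∣ d := by
    intro d
    rw [← mul_assoc, Nat.mul_dvd_mul_iff_right hu]
    exact hcop.symm.dvd_mul_right
  have hsdvd : ∀ s, s ∣ k * (w * u) ∧ s ∣ k * (a₁ * u) ↔ s ∣ k * u := by
    intro s
    rw [← Nat.dvd_gcd_iff, Nat.gcd_mul_left, Nat.gcd_mul_right, Nat.gcd_comm, hcop.gcd_eq_one,
      one_mul]
  have hdiv : ∀ s, u * (s * w) / (w * u) = s := by
    intro s
    rw [show u * (s * w) = s * (w * u) by ring]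
    exact Nat.mul_div_cancel _ hm
  have hne : k * (w * u) ≠ 0 := by positivity
  symm
  refine Finset.sum_nbij' (fun s => s * w) (fun d => d / w) ?_ ?_ ?_ ?_ ?_
  · intro s hs
    simp only [Finset.mem_filter, Nat.mem_divisors, hdvd] at hs ⊢
    refine ⟨⟨?_, hne⟩, Dvd.intro_left s rfl⟩
    rw [show k * (w * u) = k * u * w by ring]
    exact Nat.mul_dvd_mul_right ((hsdvd s).1 ⟨hs.1.1, hs.2⟩) w
  · intro d hd
    simp only [Finset.mem_filter, Nat.mem_divisors, hdvd] at hd ⊢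
    obtain ⟨⟨h1, -⟩, s, rfl⟩ := hd
    rw [Nat.mul_div_cancel_left _ hw]
    have h2 := (hsdvd s).2 (by
      rw [show k * (w * u) = w * (k * u) by ring] at h1
      exact Nat.dvd_of_mul_dvd_mul_left hw h1)
    exact ⟨⟨h2.1, hne⟩, h2.2⟩
  · intro s _
    exact Nat.mul_div_cancel _ hw
  · intro d hd
    simp only [Finset.mem_filter, hdvd] at hd
    exact Nat.div_mul_cancel hd.2
  · intro s _
    simp only [hdiv]

lemma dvd_mul_iff_div_gcd_dvd (s k a : ℕ) (hs : 0 < s) :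
    s ∣ k * a ↔ s / Nat.gcd s k ∣ a := by
  have hc : 0 < Nat.gcd s k := Nat.gcd_pos_of_pos_left k hs
  obtain ⟨s₁, k₁, hcop, h1, h2⟩ := Nat.exists_coprime s k
  generalize Nat.gcd s k = c at *
  subst h1 h2
  rw [Nat.mul_div_cancel _ hc, show k₁ * c * a = k₁ * a * c by ring,
    Nat.mul_dvd_mul_iff_right hc]
  exact hcop.dvd_mul_left

lemma card_filter_dvd_of_dvd (m t : ℕ) (hm : 0 < m) (ht : t ∣ m) :
    ((Finset.range m).filter (fun a => t ∣ a)).card = m / t := by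
  simp only [← Nat.modEq_zero_iff_dvd]
  rw [← Nat.count_eq_card_filter_range, Nat.count_modEq_card _ (Nat.pos_of_dvd_of_pos ht hm),
    Nat.mod_eq_zero_of_dvd ht]
  simp

lemma mul_gcd_mul_card_filter (k m n s : ℕ) (hk : 0 < k) (hm : 0 < m) (hs : s ∣ k * m) :
    k * (Nat.gcd s m *
        ((Finset.range m).filter (fun a => s ∣ k * a ∧ Nat.gcd s m ∣ n * a)).card)
      = k * m / s * Nat.gcd (k * m) (s * Nat.gcd s (Nat.gcd k (Nat.gcd m n))) := by
  have hs0 : 0 < s := Nat.pos_of_dvd_of_pos hs (by positivity)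
  have hb0 : 0 < Nat.gcd s m := Nat.gcd_pos_of_pos_left m hs0
  have hQ : Nat.gcd (k * m) (s * Nat.gcd s (Nat.gcd k (Nat.gcd m n)))
      = Nat.gcd (Nat.gcd s k * Nat.gcd s m) (s * Nat.gcd (Nat.gcd s m) n) := by
    refine Nat.dvd_left_iff_eq.1 fun x => ?_
    simp only [← Nat.gcd_mul_left, ← Nat.gcd_mul_right, Nat.dvd_gcd_iff, mul_comm k s]
    tauto
  have hA : s = Nat.gcd s k * (s / Nat.gcd s k) := (Nat.mul_div_cancel' (Nat.gcd_dvd_left _ _)).symm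
  have hB : Nat.gcd s m = Nat.gcd (Nat.gcd s m) n * (Nat.gcd s m / Nat.gcd (Nat.gcd s m) n) :=
    (Nat.mul_div_cancel' (Nat.gcd_dvd_left _ _)).symm
  have hAm : s / Nat.gcd s k ∣ m := (dvd_mul_iff_div_gcd_dvd s k m hs0).1 hs
  have hBm : Nat.gcd s m / Nat.gcd (Nat.gcd s m) n ∣ m :=
    (Nat.div_dvd_of_dvd (Nat.gcd_dvd_left _ _)).trans (Nat.gcd_dvd_right _ _)
  simp only [dvd_mul_iff_div_gcd_dvd s k _ hs0, dvd_mul_iff_div_gcd_dvd (Nat.gcd s m) n _ hb0,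
    ← Nat.lcm_dvd_iff]
  have hL := Nat.lcm_dvd hAm hBm
  rw [card_filter_dvd_of_dvd m _ hm hL, hQ]
  generalize hAdef : s / Nat.gcd s k = A at *
  generalize hBdef : Nat.gcd s m / Nat.gcd (Nat.gcd s m) n = B at *
  have hmain : Nat.gcd (Nat.gcd s k * Nat.gcd s m) (s * Nat.gcd (Nat.gcd s m) n) * Nat.lcm A B
      = s * Nat.gcd s m := by
    generalize Nat.gcd (Nat.gcd s m) n = r at *
    generalize Nat.gcd s m = b at *
    generalize Nat.gcd s k = c at *
    subst hA hB
    rw [show c * (r * B) = c * r * B by ring, show c * A * r = c * r * A by ring,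
      Nat.gcd_mul_left, mul_assoc, Nat.gcd_comm, Nat.gcd_mul_lcm]
    ring
  obtain ⟨q, hq⟩ := hL
  obtain ⟨t, ht⟩ := hs
  have hL0 : 0 < Nat.lcm A B := Nat.pos_of_mul_pos_right (hq ▸ hm)
  rw [ht, Nat.mul_div_cancel_left _ hs0]
  have hq' : m / Nat.lcm A B = q := by rw [hq, Nat.mul_div_cancel_left _ hL0]
  rw [hq']
  apply Nat.eq_of_mul_eq_mul_right hL0
  rw [mul_assoc t, hmain]
  calc k * (Nat.gcd s m * q) * Nat.lcm A B = k * (Nat.lcm A B * q) * Nat.gcd s m := by ring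
    _ = k * m * Nat.gcd s m := by rw [← hq]
    _ = t * (s * Nat.gcd s m) := by rw [ht]; ring

/-- A closed form of the index, depending on `m` and `n` only through `gcd (N / m) (gcd m n)`. -/
lemma indexN1star_eq_sum_divisors (N m n : ℕ) (hN : 0 < N) (hm : 0 < m) (hmN : m ∣ N) :
    indexN1star N m n = ∑ s ∈ N.divisors,
      N / s * Nat.gcd N (s * Nat.gcd s (Nat.gcd (N / m) (Nat.gcd m n))) := by
  obtain ⟨k, rfl⟩ := hmN
  rw [mul_comm m k] at *
  have hk : 0 < k := Nat.pos_of_mul_pos_right hN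
  rw [indexN1star, Nat.mul_div_cancel _ hm]
  rw [Finset.sum_congr rfl fun d _ => sum_Icc_gcd_eq_sum_filter d m n hm]
  simp only [Finset.sum_filter]
  rw [Finset.sum_comm (s := (k * m).divisors)]
  have hswap := fun a => sum_divisors_filter_dvd k m a hk hm
    (fun s => if Nat.gcd s m ∣ n * a then Nat.gcd s m else 0)
  simp only [Finset.sum_filter] at hswap
  rw [Finset.sum_congr rfl fun a _ => hswap a]
  rw [Finset.sum_comm, Finset.mul_sum]
  refine Finset.sum_congr rfl fun s hs => ?_
  rw [← mul_gcd_mul_card_filter k m n s hk hm (Nat.dvd_of_mem_divisors hs),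
    Finset.card_filter]
  congr 1
  rw [Finset.mul_sum]
  refine Finset.sum_congr rfl fun a _ => ?_
  split_ifs <;> simp_all

theorem S_duality_invariance (N m m' n n' : ℕ) (hN : 0 < N)
    (hm : 0 < m) (hmN : m ∣ N) (hm' : 0 < m') (hm'N : m' ∣ N)
    (h1 : Nat.gcd m n = N / m') (h2 : Nat.gcd m' n' = N / m) :
    indexN1star N m n = indexN1star N m' n' := by
  rw [indexN1star_eq_sum_divisors N m n hN hm hmN,
    indexN1star_eq_sum_divisors N m' n' hN hm' hm'N, h1, h2, Nat.gcd_comm (N / m)]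
end

section
/- Let n be a positive integer and let f be a polynomial with integer coefficients. Then ∑_{s=1}^{n} gcd(n, f(s)) = ∑_{d | n} (n/d) · φ(d) · ρ(d, f), where the sum on the right runs over the positive divisors d of n, φ is Euler's totient function, and ρ(d, f) denotes the number of residues s in ℤ/dℤ with f(s) ≡ 0 (mod d). -/
/-- `ρ d f` is the number of residues `s` in `ℤ/dℤ` with `f(s) ≡ 0 (mod d)`,
counted via representatives `0 ≤ s < d`. -/
def rho (d : ℕ) (f : Polynomial ℤ) : ℕ :=
  ((Finset.range d).filter (fun (s : ℕ) => (d : ℤ) ∣ f.eval (s : ℤ))).card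

/-- On an interval whose length is a multiple of the period, a periodic predicate holds
proportionally often. -/
theorem card_filter_Ico_mul_of_periodic (p : ℕ → Prop) [DecidablePred p] {d : ℕ}
    (hp : Function.Periodic p d) (a k : ℕ) :
    ((Finset.Ico a (a + d * k)).filter p).card = k * ((Finset.range d).filter p).card := by
  induction k with
  | zero => simp
  | succ k ih =>
    rw [← Finset.Ico_union_Ico_eq_Ico (Nat.le_add_right a (d * k))
        (show a + d * k ≤ a + d * (k + 1) by gcongr; omega),
      Finset.filter_union, Finset.card_union_of_disjoint
        (Finset.disjoint_filter_filter (Finset.Ico_disjoint_Ico_consecutive _ _ _)),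
      ih, mul_add, mul_one, ← add_assoc, Nat.filter_Ico_card_eq_of_periodic _ _ _ hp,
      Nat.count_eq_card_filter_range]
    ring

theorem periodic_dvd_eval (f : Polynomial ℤ) (d : ℕ) :
    Function.Periodic (fun s : ℕ => (d : ℤ) ∣ f.eval (s : ℤ)) d := by
  intro s
  have h := f.sub_dvd_eval_sub ((s + d : ℕ) : ℤ) (s : ℤ)
  rw [Nat.cast_add, add_sub_cancel_left] at h
  simpa using dvd_iff_dvd_of_dvd_sub h

theorem card_filter_dvd_eval (f : Polynomial ℤ) {n d : ℕ} (hd : d ∣ n) (hn : 0 < n) :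
    ((Finset.Icc 1 n).filter (fun s : ℕ => (d : ℤ) ∣ f.eval (s : ℤ))).card =
      n / d * rho d f := by
  obtain ⟨k, rfl⟩ := hd
  rw [Nat.mul_div_cancel_left k (Nat.pos_of_mul_pos_right hn), rho,
    ← card_filter_Ico_mul_of_periodic _ (periodic_dvd_eval f d) 1 k]
  congr 2
  ext s
  simp only [Finset.mem_Icc, Finset.mem_Ico]
  omega

/-- The greatest common divisor as a sum of totients over common divisors. -/
theorem gcd_natAbs_eq_sum_totient {n : ℕ} (hn : 0 < n) (m : ℤ) :
    Nat.gcd n m.natAbs = ∑ d ∈ n.divisors, if (d : ℤ) ∣ m then Nat.totient d else 0 := by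
  rw [← Finset.sum_filter, ← Nat.sum_totient (Nat.gcd n m.natAbs)]
  refine Finset.sum_congr ?_ fun _ _ => rfl
  ext d
  simp [Nat.dvd_gcd_iff, Int.natCast_dvd, hn.ne']

theorem sum_gcd_poly (n : ℕ) (hn : 0 < n) (f : Polynomial ℤ) :
    ∑ s ∈ Finset.Icc 1 n, Nat.gcd n (f.eval (s : ℤ)).natAbs
      = ∑ d ∈ n.divisors, n / d * Nat.totient d * rho d f := by
  simp_rw [gcd_natAbs_eq_sum_totient hn]
  rw [Finset.sum_comm]
  refine Finset.sum_congr rfl fun d hd => ?_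
  rw [← Finset.sum_filter, Finset.sum_const, card_filter_dvd_eval f (Nat.dvd_of_mem_divisors hd) hn,
    smul_eq_mul]
  ring
end

section
/- Let n be a positive integer and let a, b be integers. Then ∑_{s=1}^{n} gcd(n, a·s + b) = ∑_{d | n} (n/d) · φ(d) · gcd(a, d) · [gcd(a, d) divides b], where the sum on the right runs over the positive divisors d of n, φ is Euler's totient function, and [P] equals 1 if the condition P holds and 0 otherwise. -/
/-- A residue class modulo `m` meets `{1, …, m * k}` in exactly `k` elements. -/
theorem card_Icc_filter_modEq_mul (m k v : ℕ) (hm : 0 < m) :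
    ((Finset.Icc 1 (m * k)).filter fun s => s ≡ v [MOD m]).card = k := by
  have h := Nat.Ioc_filter_modEq_card 0 (m * k) hm v
  have hm' : (m : ℚ) ≠ 0 := by positivity
  have e : (((m * k : ℕ) : ℚ) - v) / m = ((0 : ℕ) - v : ℚ) / m + (k : ℕ) := by
    push_cast
    field_simp
    ring
  rw [e, Int.floor_add_natCast, add_sub_cancel_left, max_eq_left (by positivity)] at h
  exact_mod_cast h

/-- A linear congruence with leading coefficient coprime to the modulus has a unique solution. -/
theorem exists_dvd_affine_iff_modEq (m : ℕ) (hm : 0 < m) (a b : ℤ) (h : IsCoprime a (m : ℤ)) :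
    ∃ v : ℕ, ∀ s : ℕ, (m : ℤ) ∣ a * s + b ↔ s ≡ v [MOD m] := by
  obtain ⟨u, w, huw⟩ := h
  have hm' : (m : ℤ) ≠ 0 := by positivity
  refine ⟨((-b * u) % m).toNat, fun s => ?_⟩
  rw [← Int.natCast_modEq_iff, Int.toNat_of_nonneg (Int.emod_nonneg _ hm')]
  have hmod : (s : ℤ) ≡ (-b * u) % m [ZMOD m] ↔ (s : ℤ) ≡ -b * u [ZMOD m] := by
    simp [Int.ModEq]
  rw [hmod, Int.modEq_comm, Int.modEq_iff_dvd]
  constructor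
  · rintro ⟨c, hc⟩
    exact ⟨u * c + w * s, by linear_combination u * hc - s * huw⟩
  · rintro ⟨c, hc⟩
    exact ⟨a * c + w * b, by linear_combination a * hc - b * huw⟩

theorem card_Icc_filter_dvd_affine (n d : ℕ) (hn : 0 < n) (hd : d ∣ n) (a b : ℤ) :
    ((Finset.Icc 1 n).filter fun s : ℕ => (d : ℤ) ∣ a * s + b).card
      = n / d * Int.gcd a d * (if (Int.gcd a d : ℤ) ∣ b then 1 else 0) := by
  have hd0 : 0 < d := Nat.pos_of_dvd_of_pos hd hn
  have hg0 : 0 < Int.gcd a d := Int.gcd_pos_of_ne_zero_right _ (by positivity)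
  obtain ⟨a', ha⟩ : (Int.gcd a d : ℤ) ∣ a := Int.gcd_dvd_left ..
  obtain ⟨m, hm⟩ : Int.gcd a d ∣ d := Int.natCast_dvd_natCast.1 (Int.gcd_dvd_right ..)
  obtain ⟨k, rfl⟩ := hd
  have hcop : IsCoprime a' (m : ℤ) := by
    rw [Int.isCoprime_iff_gcd_eq_one]
    have h : Int.gcd a d = Int.gcd a d * Int.gcd a' m := by
      calc Int.gcd a d = Int.gcd (Int.gcd a d * a') ((Int.gcd a d * m : ℕ) : ℤ) := by
            rw [← ha, ← hm]
        _ = Int.gcd a d * Int.gcd a' m := by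
            rw [Nat.cast_mul, Int.gcd_mul_left, Int.natAbs_natCast]
    exact (Nat.eq_of_mul_eq_mul_left hg0 (by rw [mul_one]; exact h)).symm
  generalize Int.gcd a d = g at *
  subst ha hm
  have hg : (g : ℤ) ≠ 0 := by positivity
  rw [Nat.mul_div_cancel_left _ hd0]
  split_ifs with hb
  · obtain ⟨b', rfl⟩ := hb
    have hm0 : 0 < m := Nat.pos_of_mul_pos_left hd0
    obtain ⟨v, hv⟩ := exists_dvd_affine_iff_modEq m hm0 a' b' hcop
    have hs : ∀ s : ℕ, ((g * m : ℕ) : ℤ) ∣ g * a' * s + g * b' ↔ s ≡ v [MOD m] := fun s => by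
      rw [← hv, Nat.cast_mul, mul_assoc, ← mul_add, mul_dvd_mul_iff_left hg]
    simp only [hs]
    rw [show g * m * k = m * (k * g) by ring, card_Icc_filter_modEq_mul m _ v hm0, mul_one]
  · rw [mul_zero, Finset.card_eq_zero, Finset.filter_eq_empty_iff]
    intro s _ h
    refine hb ((dvd_add_right (?_ : (g : ℤ) ∣ g * a' * s)).1 (dvd_trans ?_ h))
    · exact ⟨a' * s, by ring⟩
    · exact ⟨m, by push_cast; ring⟩

theorem sum_gcd_affine (n : ℕ) (hn : 0 < n) (a b : ℤ) :
    ∑ s ∈ Finset.Icc 1 n, Nat.gcd n (a * (s : ℤ) + b).natAbs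
      = ∑ d ∈ n.divisors,
          n / d * Nat.totient d * Int.gcd a d * (if (Int.gcd a d : ℤ) ∣ b then 1 else 0) := by
  have hgcd : ∀ s : ℕ, Nat.gcd n (a * (s : ℤ) + b).natAbs
      = ∑ d ∈ n.divisors, if (d : ℤ) ∣ a * s + b then Nat.totient d else 0 := fun s => by
    rw [← Finset.sum_filter]
    conv_lhs => rw [← Nat.sum_totient (Nat.gcd n _)]
    refine Finset.sum_congr ?_ fun _ _ => rfl
    ext d
    simp [Nat.dvd_gcd_iff, Int.natCast_dvd, hn.ne']
  simp only [hgcd]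
  rw [Finset.sum_comm]
  refine Finset.sum_congr rfl fun d hd => ?_
  rw [← Finset.sum_filter, Finset.sum_const, smul_eq_mul,
    card_Icc_filter_dvd_affine n d hn (Nat.dvd_of_mem_divisors hd)]
  ring
end

section
/- For every positive integer N, ∑_{n | N} ∑_{k=1}^{n} gcd(k, n) = N · σ₀(N), where the outer sum runs over the positive divisors n of N and σ₀(N) denotes the number of positive divisors of N. -/
/-- Pillai's function `n ↦ ∑ k ∈ [1, n], gcd(k, n)` is the Dirichlet convolution of `φ` with the
identity. -/
theorem sum_Icc_gcd_eq_sum_divisorsAntidiagonal (n : ℕ) :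
    ∑ k ∈ Finset.Icc 1 n, Nat.gcd k n = ∑ x ∈ n.divisorsAntidiagonal, x.1.totient * x.2 := by
  rw [Nat.sum_divisorsAntidiagonal fun a b => a.totient * b]
  rcases Nat.eq_zero_or_pos n with rfl | hn
  · simp
  have gcd_eq (k : ℕ) : Nat.gcd k n = ∑ d ∈ n.divisors, if d ∣ k then d.totient else 0 := by
    rw [← Finset.sum_filter]
    conv_lhs => rw [← Nat.sum_totient (Nat.gcd k n)]
    refine Finset.sum_congr ?_ fun _ _ => rfl
    ext d
    simp [Nat.dvd_gcd_iff, hn.ne', and_comm]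
  simp_rw [gcd_eq]
  rw [Finset.sum_comm]
  refine Finset.sum_congr rfl fun d _ => ?_
  rw [← Finset.sum_filter, Finset.sum_const, smul_eq_mul, mul_comm]
  congr 1
  exact Nat.Ioc_filter_dvd_card_eq_div n d

theorem double_sum_gcd_eq (N : ℕ) (hN : 0 < N) :
    ∑ n ∈ N.divisors, ∑ k ∈ Finset.Icc 1 n, Nat.gcd k n = N * N.divisors.card := by
  let totient : ArithmeticFunction ℕ := ⟨Nat.totient, Nat.totient_zero⟩
  let ident : ArithmeticFunction ℕ := ⟨fun n => n, rfl⟩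
  have zeta_mul_totient : (ArithmeticFunction.zeta : ArithmeticFunction ℕ) * totient = ident := by
    ext n
    rw [ArithmeticFunction.zeta_mul_apply]
    exact Nat.sum_totient n
  calc ∑ n ∈ N.divisors, ∑ k ∈ Finset.Icc 1 n, Nat.gcd k n
      = (ArithmeticFunction.zeta * (totient * ident)) N := by
        rw [ArithmeticFunction.zeta_mul_apply]
        exact Finset.sum_congr rfl fun n _ => sum_Icc_gcd_eq_sum_divisorsAntidiagonal n
    _ = (ident * ident) N := by rw [← mul_assoc, zeta_mul_totient]
    _ = ∑ x ∈ N.divisorsAntidiagonal, x.1 * x.2 := ArithmeticFunction.mul_apply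
    _ = ∑ _d ∈ N.divisors, N := by
        rw [Nat.sum_divisorsAntidiagonal fun a b => a * b]
        exact Finset.sum_congr rfl fun d hd => Nat.mul_div_cancel' (Nat.dvd_of_mem_divisors hd)
    _ = N * N.divisors.card := by rw [Finset.sum_const, smul_eq_mul, mul_comm]
end

section
/- Let δ be a positive integer, let d' and m' be integers with gcd(d', m') = 1, and let n be an integer. Then there exists an integer a such that gcd(δ, a·d' + n) = gcd(δ, n·m'). -/
/-- A residue class coprime to its modulus `d` contains an integer coprime to a given positive
integer. -/
theorem exists_isCoprime_add_mul {x d : ℤ} (h : IsCoprime x d) {m : ℕ} (hm : m ≠ 0) :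
    ∃ k : ℤ, IsCoprime (x + k * d) (m : ℤ) := by
  let ps : Finset ℕ := {p ∈ m.primeFactors | ¬(p : ℤ) ∣ x}
  refine ⟨∏ p ∈ ps, (p : ℤ), ?_⟩
  rw [Int.isCoprime_iff_gcd_eq_one]
  by_contra hne
  obtain ⟨p, hp, hpg⟩ := Nat.exists_prime_and_dvd hne
  have hpI : Prime (p : ℤ) := Nat.prime_iff_prime_int.mp hp
  have hpg' : (p : ℤ) ∣ Int.gcd (x + (∏ p ∈ ps, (p : ℤ)) * d) m := Int.natCast_dvd_natCast.mpr hpg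
  have hpx : (p : ℤ) ∣ x + (∏ p ∈ ps, (p : ℤ)) * d := hpg'.trans (Int.gcd_dvd_left ..)
  have hpm : p ∣ m := Int.natCast_dvd_natCast.mp (hpg'.trans (Int.gcd_dvd_right ..))
  by_cases hx : (p : ℤ) ∣ x
  · rcases hpI.dvd_or_dvd ((dvd_add_right hx).mp hpx) with hprod | hd
    · obtain ⟨q, hq, hpq⟩ := (hpI.dvd_finsetProd_iff _).mp hprod
      obtain ⟨hqm, hqx⟩ := Finset.mem_filter.mp hq
      have hpq' : p = q := (Nat.prime_dvd_prime_iff_eq hp (Nat.prime_of_mem_primeFactors hqm)).mp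
        (Int.natCast_dvd_natCast.mp hpq)
      exact hqx (hpq' ▸ hx)
    · exact hpI.not_isUnit (h.isUnit_of_dvd' hx hd)
  · have hps : p ∈ ps := Finset.mem_filter.mpr ⟨Nat.mem_primeFactors.mpr ⟨hp, hpm, hm⟩, hx⟩
    have hprod : (p : ℤ) ∣ ∏ p ∈ ps, (p : ℤ) := Finset.dvd_prod_of_mem (fun p : ℕ ↦ (p : ℤ)) hps
    exact hx ((dvd_add_left (hprod.mul_right d)).mp hpx)

theorem exists_gcd_eq (δ : ℕ) (hδ : 0 < δ) (d' m' : ℤ) (h : Int.gcd d' m' = 1) (n : ℤ) :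
    ∃ a : ℤ, Int.gcd (δ : ℤ) (a * d' + n) = Int.gcd (δ : ℤ) (n * m') := by
  -- Multiply `n * m'` by an inverse of `m'` modulo `d'` that is coprime to `δ`.
  obtain ⟨y, x, hxy⟩ := Int.isCoprime_iff_gcd_eq_one.mpr h
  obtain ⟨k, hk⟩ := exists_isCoprime_add_mul (x := x) (d := d') ⟨m', y, by linarith⟩ hδ.ne'
  refine ⟨n * (k * m' - y), ?_⟩
  have heq : n * (k * m' - y) * d' + n = (x + k * d') * (n * m') := by
    linear_combination (-n) * hxy
  rw [heq]
  exact Int.gcd_mul_right_right_of_gcd_eq_one (Int.isCoprime_iff_gcd_eq_one.mp hk.symm)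
end

section
/- Let δ be a positive integer, let d be an integer, and let a, b be integers. Suppose there exist integers t and t' with gcd(δ, a + d·t) = gcd(δ, b + d·t'). Then there exists an integer c such that for every integer t, gcd(δ, b + d·t) = gcd(δ, a + d·(t + c)). In other words, if the cyclic ordered sequences D_a(δ,d) = [ gcd(δ, a + d·t) ]_{t ∈ ℤ/δℤ} and D_b(δ,d) have an element in common, then they are equal as cyclic ordered sequences. -/
theorem Int.gcd_eq_gcd_of_modEq {m x y : ℤ} (h : x ≡ y [ZMOD m]) : Int.gcd m x = Int.gcd m y := by
  obtain ⟨k, hk⟩ := Int.modEq_iff_dvd.mp h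
  rw [eq_add_of_sub_eq' hk, Int.gcd_add_mul_left_right]

theorem Int.gcd_natCast_mul_of_coprime {m n : ℕ} (h : m.Coprime n) (x : ℤ) :
    Int.gcd ((m * n : ℕ) : ℤ) x = Int.gcd (m : ℤ) x * Int.gcd (n : ℤ) x := by
  simp only [Int.gcd_def, Int.natAbs_natCast]
  rw [Nat.gcd_comm, h.gcd_mul, Nat.gcd_comm _ m, Nat.gcd_comm _ n]

theorem Int.gcd_eq_gcd_of_dvd_natCast {m n : ℕ} (hmn : m ∣ n) {a b : ℤ}
    (h : Int.gcd (n : ℤ) a = Int.gcd (n : ℤ) b) : Int.gcd (m : ℤ) a = Int.gcd (m : ℤ) b := by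
  simp only [Int.gcd_def, Int.natAbs_natCast] at h ⊢
  rw [← Nat.gcd_eq_left hmn, Nat.gcd_assoc, h, ← Nat.gcd_assoc]

/-- If the divisor `g` of the prime power `p ^ n` does not divide `x`, then `p ^ n` and `g` have
the same greatest common divisor with `x`. -/
theorem Int.gcd_prime_pow_eq_gcd_of_not_dvd {p n g : ℕ} (hp : p.Prime) (hg : g ∣ p ^ n) {x : ℤ}
    (hx : ¬ (g : ℤ) ∣ x) : Int.gcd ((p ^ n : ℕ) : ℤ) x = Int.gcd (g : ℤ) x := by
  have hl : Int.gcd ((p ^ n : ℕ) : ℤ) x ∣ p ^ n :=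
    Int.natCast_dvd_natCast.mp (Int.gcd_dvd_left _ _)
  have hr : ((Int.gcd ((p ^ n : ℕ) : ℤ) x : ℕ) : ℤ) ∣ x := Int.gcd_dvd_right _ _
  obtain ⟨i, -, hi⟩ := (Nat.dvd_prime_pow hp).mp hl
  obtain ⟨j, -, rfl⟩ := (Nat.dvd_prime_pow hp).mp hg
  have hij : i ≤ j := by
    by_contra hji
    refine hx (dvd_trans ?_ hr)
    rw [hi]
    exact Int.natCast_dvd_natCast.mpr (pow_dvd_pow p (by omega))
  apply Nat.dvd_antisymm
  · refine Int.dvd_gcd ?_ hr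
    rw [hi]
    exact Int.natCast_dvd_natCast.mpr (pow_dvd_pow p hij)
  · exact Int.dvd_gcd ((Int.gcd_dvd_left _ _).trans (Int.natCast_dvd_natCast.mpr hg))
      (Int.gcd_dvd_right _ _)

theorem Int.exists_mul_modEq_of_gcd_dvd {m d x : ℤ} (h : (Int.gcd m d : ℤ) ∣ x) :
    ∃ c : ℤ, d * c ≡ x [ZMOD m] := by
  obtain ⟨k, rfl⟩ := h
  refine ⟨Int.gcdB m d * k, Int.modEq_iff_dvd.mpr ⟨Int.gcdA m d * k, ?_⟩⟩
  rw [Int.gcd_eq_gcd_ab]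
  ring

theorem Int.exists_shift_of_gcd_prime_pow_eq {p n : ℕ} (hp : p.Prime) {d a b : ℤ}
    (h : Int.gcd ((p ^ n : ℕ) : ℤ) a = Int.gcd ((p ^ n : ℕ) : ℤ) b) :
    ∃ c : ℤ, ∀ t : ℤ, Int.gcd ((p ^ n : ℕ) : ℤ) (b + d * t) =
      Int.gcd ((p ^ n : ℕ) : ℤ) (a + d * (t + c)) := by
  set g := Int.gcd ((p ^ n : ℕ) : ℤ) d
  have hg : g ∣ p ^ n := Int.natCast_dvd_natCast.mp (Int.gcd_dvd_left _ _)
  have hgd : (g : ℤ) ∣ d := Int.gcd_dvd_right _ _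
  have hgab : Int.gcd (g : ℤ) a = Int.gcd (g : ℤ) b := Int.gcd_eq_gcd_of_dvd_natCast hg h
  have hdvd : (g : ℤ) ∣ a ↔ (g : ℤ) ∣ b := by
    rw [← Int.gcd_eq_left_iff_dvd (by positivity), hgab,
      Int.gcd_eq_left_iff_dvd (by positivity)]
  by_cases ha : (g : ℤ) ∣ a
  · obtain ⟨c, hc⟩ := Int.exists_mul_modEq_of_gcd_dvd (dvd_sub (hdvd.mp ha) ha)
    refine ⟨c, fun t => Int.gcd_eq_gcd_of_modEq ?_⟩
    convert (hc.symm.add_left (a + d * t)) using 1 <;> ring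
  · have hconst : ∀ x : ℤ, ¬ (g : ℤ) ∣ x → ∀ t : ℤ,
        Int.gcd ((p ^ n : ℕ) : ℤ) (x + d * t) = Int.gcd (g : ℤ) x := by
      intro x hx t
      rw [Int.gcd_prime_pow_eq_gcd_of_not_dvd hp hg
        (by rwa [dvd_add_left (hgd.mul_right t)])]
      exact Int.gcd_eq_gcd_of_modEq (Int.modEq_iff_dvd.mpr (by simpa using hgd.mul_right t))
    refine ⟨0, fun t => ?_⟩
    rw [hconst b (mt hdvd.mpr ha), hconst a ha, hgab]

theorem Int.exists_shift_of_gcd_eq {δ : ℕ} (hδ : 0 < δ) (d a b : ℤ)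
    (h : Int.gcd (δ : ℤ) a = Int.gcd (δ : ℤ) b) :
    ∃ c : ℤ, ∀ t : ℤ, Int.gcd (δ : ℤ) (b + d * t) = Int.gcd (δ : ℤ) (a + d * (t + c)) := by
  induction δ using Nat.recOnPosPrimePosCoprime with
  | prime_pow p n hp _ => exact Int.exists_shift_of_gcd_prime_pow_eq hp h
  | zero => exact absurd hδ (lt_irrefl 0)
  | one => exact ⟨0, fun t => by simp⟩
  | coprime m n hm hn hmn ihm ihn =>
    obtain ⟨c₁, hc₁⟩ := ihm (by omega) (Int.gcd_eq_gcd_of_dvd_natCast (dvd_mul_right m n) h)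
    obtain ⟨c₂, hc₂⟩ := ihn (by omega) (Int.gcd_eq_gcd_of_dvd_natCast (dvd_mul_left n m) h)
    have hone : (m : ℤ) * Int.gcdA m n + n * Int.gcdB m n = 1 := by
      rw [← Int.gcd_eq_gcd_ab, Int.gcd_natCast_natCast, hmn.gcd_eq_one, Nat.cast_one]
    refine ⟨c₁ + m * (Int.gcdA m n * (c₂ - c₁)), fun t => ?_⟩
    rw [Int.gcd_natCast_mul_of_coprime hmn, Int.gcd_natCast_mul_of_coprime hmn, hc₁, hc₂]
    congr 1
    · refine Int.gcd_eq_gcd_of_modEq (Int.modEq_iff_dvd.mpr ⟨d * (Int.gcdA m n * (c₂ - c₁)), ?_⟩)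
      ring
    · refine Int.gcd_eq_gcd_of_modEq
        (Int.modEq_iff_dvd.mpr ⟨- (d * (Int.gcdB m n * (c₂ - c₁))), ?_⟩)
      linear_combination (d * (c₂ - c₁)) * hone

theorem cyclic_sequences_eq_of_common_element (δ : ℕ) (hδ : 0 < δ) (d a b : ℤ)
    (h : ∃ t t' : ℤ, Int.gcd (δ : ℤ) (a + d * t) = Int.gcd (δ : ℤ) (b + d * t')) :
    ∃ c : ℤ, ∀ t : ℤ, Int.gcd (δ : ℤ) (b + d * t) = Int.gcd (δ : ℤ) (a + d * (t + c)) := by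
  obtain ⟨s, s', hs⟩ := h
  obtain ⟨c, hc⟩ := Int.exists_shift_of_gcd_eq hδ d _ _ hs
  refine ⟨s - s' + c, fun t => ?_⟩
  convert hc (t - s') using 2 <;> ring
end

section
/- Let N be a positive integer, let m and d be positive divisors of N, and let t and n be natural numbers. Then gcd(d, m) divides t·d + n·m, and gcd( (N/m)·d, (N/d)·m, (N/m)·t + (N/d)·n ) = (N / lcm(m, d)) · gcd( d, m, (t·d + n·m)/gcd(d, m) ). -/
theorem gcd_lattice_factorization (N m d t n : ℕ) (hN : 0 < N)
    (hm : 0 < m) (hmN : m ∣ N) (hd : 0 < d) (hdN : d ∣ N) :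
    Nat.gcd d m ∣ t * d + n * m ∧
    Nat.gcd (N / m * d) (Nat.gcd (N / d * m) (N / m * t + N / d * n))
      = N / Nat.lcm m d * Nat.gcd d (Nat.gcd m ((t * d + n * m) / Nat.gcd d m)) := by
  refine ⟨dvd_add ((Nat.gcd_dvd_left d m).mul_left t) ((Nat.gcd_dvd_right d m).mul_left n), ?_⟩
  obtain ⟨k, hk⟩ := Nat.lcm_dvd hmN hdN
  obtain ⟨g, a, b, hg, hab, rfl, rfl⟩ := Nat.exists_coprime' (Nat.gcd_pos_of_pos_left m hd)
  have hgcd : Nat.gcd (a * g) (b * g) = g := by rw [Nat.gcd_mul_right, hab.gcd_eq_one, one_mul]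
  have hlcm : Nat.lcm (b * g) (a * g) = b * a * g := by
    rw [Nat.lcm_mul_right, hab.symm.lcm_eq_mul]
  have hlcm_pos : 0 < b * a * g := hlcm ▸ Nat.lcm_pos hm hd
  rw [hlcm] at hk
  have hNm : N / (b * g) = k * a := Nat.div_eq_of_eq_mul_right hm (by rw [hk]; ring)
  have hNd : N / (a * g) = k * b := Nat.div_eq_of_eq_mul_right hd (by rw [hk]; ring)
  have hNl : N / (b * a * g) = k := Nat.div_eq_of_eq_mul_right hlcm_pos hk
  have hquot : (t * (a * g) + n * (b * g)) / g = a * t + b * n :=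
    Nat.div_eq_of_eq_mul_right hg (by ring)
  have hsq : Nat.gcd (a * (a * g)) (b * (b * g)) = g := by
    rw [← mul_assoc, ← mul_assoc, Nat.gcd_mul_right, (hab.mul_left hab).mul_right
      (hab.mul_left hab) |>.gcd_eq_one, one_mul]
  rw [hgcd, hlcm, hNm, hNd, hNl, hquot, ← Nat.gcd_assoc (a * g), hgcd]
  simp only [mul_assoc k, ← mul_add]
  rw [Nat.gcd_mul_left, Nat.gcd_mul_left, ← Nat.gcd_assoc, hsq]
end

section
/- Let N be a positive integer, let m and d be positive divisors of N, and let n be a natural number. Then gcd(d, m) · gcd( m, N/d, (m·n)/gcd(d, m) ) = m · gcd(d, m, N/d, N/m, n). -/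
theorem gcd_regrouping_identity (N m d n : ℕ) (hN : 0 < N)
    (hm : 0 < m) (hmN : m ∣ N) (hd : 0 < d) (hdN : d ∣ N) :
    Nat.gcd d m * Nat.gcd m (Nat.gcd (N / d) (m * n / Nat.gcd d m))
      = m * Nat.gcd d (Nat.gcd m (Nat.gcd (N / d) (Nat.gcd (N / m) n))) := by
  have hquot : Nat.gcd d m * (m * n / Nat.gcd d m) = m * n :=
    Nat.mul_div_cancel' ((Nat.gcd_dvd_right d m).mul_right n)
  have hgm : Nat.gcd d m * m = Nat.gcd (m * d) (m * m) := by
    rw [Nat.gcd_mul_left, mul_comm]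
  have hgN : Nat.gcd d m * (N / d) = Nat.gcd N (m * (N / d)) := by
    rw [← Nat.gcd_mul_right, Nat.mul_div_cancel' hdN]
  simp only [← Nat.gcd_mul_left, hquot, hgm, hgN, Nat.mul_div_cancel' hmN]
  ac_rfl
end

section
/- Let m be a positive integer, let e be a positive divisor of m, let d be a positive integer, and let n be a natural number. Then gcd( (d·e)/gcd(d·e, m), e ) divides n if and only if e · gcd(d, m) divides m·n. -/
theorem delta_condition_equiv (m e d n : ℕ) (hm : 0 < m) (he : 0 < e) (hem : e ∣ m)
    (hd : 0 < d) :
    Nat.gcd (d * e / Nat.gcd (d * e) m) e ∣ n ↔ e * Nat.gcd d m ∣ m * n := by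
  obtain ⟨k, rfl⟩ := hem
  obtain ⟨g, a, b, hg, hab, rfl, rfl⟩ := Nat.exists_coprime' (Nat.gcd_pos_of_pos_left k hd)
  have hquot : a * g * e / Nat.gcd (a * g * e) (e * (b * g)) = a := by
    have hgcd : Nat.gcd (a * g * e) (e * (b * g)) = g * e := by
      rw [show a * g * e = a * (g * e) by ring, show e * (b * g) = b * (g * e) by ring,
        Nat.gcd_mul_right, hab.gcd_eq_one, one_mul]
    rw [hgcd, mul_assoc, Nat.mul_div_cancel _ (Nat.mul_pos hg he)]
  have hgcd : Nat.gcd (a * g) (e * (b * g)) = Nat.gcd a e * g := by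
    rw [← mul_assoc, Nat.gcd_mul_right, Nat.Coprime.gcd_mul_right_cancel_right e hab.symm]
  rw [hquot, hgcd, show e * (Nat.gcd a e * g) = e * g * Nat.gcd a e by ring,
    show e * (b * g) * n = e * g * (b * n) by ring,
    Nat.mul_dvd_mul_iff_left (Nat.mul_pos he hg)]
  exact (Nat.Coprime.dvd_mul_left (hab.coprime_dvd_left (Nat.gcd_dvd_left a e))).symm
end

section
/- Let N be a positive integer, let m and d be positive divisors of N, and let t and n be integers. Let L be the subgroup of ℤ² generated by the four vectors u₁ = (d, 0), u₂ = (t, N/d), u₃ = (m, 0), u₄ = (−n, N/m). Then the quotient group ℤ²/L is finite and its cardinality equals gcd( (N/m)·d, (N/d)·m, (N/m)·t + (N/d)·n ). -/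
/-- The sublattice of `ℤ^ι` spanned by a linearly independent family indexed by `ι` has index
the absolute value of the determinant of the family. -/
theorem card_quotient_span_range_eq_natAbs_det {ι : Type*} [Fintype ι] [DecidableEq ι]
    {v : ι → ι → ℤ} (hv : LinearIndependent ℤ v) :
    Nat.card ((ι → ℤ) ⧸ Submodule.span ℤ (Set.range v)) = (Matrix.of v).det.natAbs := by
  rw [← Submodule.natAbs_det_basis_change (Pi.basisFun ℤ ι) _ (Module.Basis.span hv)]
  have h : ((↑) ∘ Module.Basis.span hv : ι → ι → ℤ) = v := by
    ext i : 1
    simp [Module.Basis.span_apply]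
  rw [h, Pi.basisFun_det_apply]

/-- The sublattice of `ℤ²` with basis `(k, 0)`, `(s, h)` has index `k * h`. -/
theorem card_quotient_span_triangular {k h : ℕ} (hk : k ≠ 0) (hh : h ≠ 0) (s : ℤ) :
    Nat.card ((Fin 2 → ℤ) ⧸ Submodule.span ℤ
      ({![(k : ℤ), 0], ![s, (h : ℤ)]} : Set (Fin 2 → ℤ))) = k * h := by
  have hdet : (Matrix.of ![![(k : ℤ), 0], ![s, (h : ℤ)]]).det = (k * h : ℕ) := by
    simp [Matrix.det_fin_two]
  have hv : LinearIndependent ℤ ![![(k : ℤ), 0], ![s, (h : ℤ)]] := by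
    apply Matrix.linearIndependent_rows_of_det_ne_zero
      (A := Matrix.of ![![(k : ℤ), 0], ![s, (h : ℤ)]])
    rw [hdet]
    exact_mod_cast mul_ne_zero hk hh
  have hcard := card_quotient_span_range_eq_natAbs_det hv
  rwa [hdet, Int.natAbs_natCast, Matrix.range_cons_cons_empty] at hcard

/-- Hermite reduction of the sublattice of `ℤ²` generated by two horizontal vectors and two
further vectors whose second coordinates are `a * h` and `b * h` with `a`, `b` coprime. -/
theorem span_four_eq_span_triangular {d m a b h x y t n : ℤ} (hxy : x * a + y * b = 1) :
    Submodule.span ℤ ({![d, 0], ![t, a * h], ![m, 0], ![-n, b * h]} : Set (Fin 2 → ℤ)) =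
      Submodule.span ℤ
        {![(Int.gcd (Int.gcd d m) (b * t + a * n) : ℤ), 0], ![x * t - y * n, h]} := by
  set k : ℤ := (Int.gcd (Int.gcd d m) (b * t + a * n) : ℤ) with hk
  apply le_antisymm
  · obtain ⟨d', hd'⟩ : k ∣ d := (Int.gcd_dvd_left _ _).trans (Int.gcd_dvd_left _ _)
    obtain ⟨m', hm'⟩ : k ∣ m := (Int.gcd_dvd_left _ _).trans (Int.gcd_dvd_right _ _)
    obtain ⟨c, hc⟩ : k ∣ b * t + a * n := Int.gcd_dvd_right _ _
    rw [Submodule.span_le]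
    rintro v (rfl | rfl | rfl | rfl) <;> rw [SetLike.mem_coe, Submodule.mem_span_pair]
    · refine ⟨d', 0, ?_⟩
      ext i
      fin_cases i
      · simp [hd', mul_comm]
      · simp
    · refine ⟨y * c, a, ?_⟩
      ext i
      fin_cases i
      · simp
        linear_combination (-y) * hc + t * hxy
      · simp
    · refine ⟨m', 0, ?_⟩
      ext i
      fin_cases i
      · simp [hm', mul_comm]
      · simp
    · refine ⟨-x * c, b, ?_⟩
      ext i
      fin_cases i
      · simp
        linear_combination x * hc - n * hxy
      · simp
  · have hbez := Int.gcd_eq_gcd_ab (Int.gcd d m) (b * t + a * n)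
    have hbez' := Int.gcd_eq_gcd_ab d m
    rw [← hk] at hbez
    generalize Int.gcdA (Int.gcd d m) (b * t + a * n) = p at hbez
    generalize Int.gcdB (Int.gcd d m) (b * t + a * n) = q at hbez
    rw [Submodule.span_le]
    rintro v (rfl | rfl) <;> rw [SetLike.mem_coe]
    · have hv : (![k, 0] : Fin 2 → ℤ) = (Int.gcdA d m * p) • ![d, 0] + (b * q) • ![t, a * h]
          + (Int.gcdB d m * p) • ![m, 0] + (-a * q) • ![-n, b * h] := by
        ext i
        fin_cases i
        · simp
          linear_combination hbez + p * hbez'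
        · simp
          ring
      rw [hv]
      refine add_mem (add_mem (add_mem ?_ ?_) ?_) ?_ <;>
        exact Submodule.smul_mem _ _ (Submodule.subset_span (by simp))
    · have hv : (![x * t - y * n, h] : Fin 2 → ℤ) = x • ![t, a * h] + y • ![-n, b * h] := by
        ext i
        fin_cases i
        · simp
          ring
        · simp
          linear_combination (-h) * hxy
      rw [hv]
      refine add_mem ?_ ?_ <;>
        exact Submodule.smul_mem _ _ (Submodule.subset_span (by simp))

/-- If `A * d = B * m`, then the product of gcds `gcd A B * gcd d m` is `gcd (B * d) (A * m)`. -/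
theorem gcd_mul_gcd_eq_gcd_cross {A B d m : ℕ} (h : A * d = B * m) :
    Nat.gcd A B * Nat.gcd d m = Nat.gcd (B * d) (A * m) := by
  have hdvd : Nat.gcd (B * d) (A * m) ∣ A * d := by
    rw [← Nat.pow_dvd_pow_iff two_ne_zero, sq]
    refine (mul_dvd_mul (Nat.gcd_dvd_left _ _) (Nat.gcd_dvd_right _ _)).trans (dvd_of_eq ?_)
    calc B * d * (A * m) = A * d * (B * m) := by ring
      _ = (A * d) ^ 2 := by rw [← h, sq]
  apply Nat.dvd_antisymm
  · apply Nat.dvd_gcd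
    · exact mul_dvd_mul (Nat.gcd_dvd_right _ _) (Nat.gcd_dvd_left _ _)
    · exact mul_dvd_mul (Nat.gcd_dvd_left _ _) (Nat.gcd_dvd_right _ _)
  · rw [← Nat.gcd_mul_right, ← Nat.gcd_mul_left, ← Nat.gcd_mul_left]
    refine Nat.dvd_gcd (Nat.dvd_gcd hdvd (Nat.gcd_dvd_right _ _))
      (Nat.dvd_gcd (Nat.gcd_dvd_left _ _) (h ▸ hdvd))

theorem vacuum_lattice_multiplicity (N m d : ℕ) (t n : ℤ) (hN : 0 < N)
    (hm : 0 < m) (hmN : m ∣ N) (hd : 0 < d) (hdN : d ∣ N) :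
    Finite ((Fin 2 → ℤ) ⧸ Submodule.span ℤ
      ({![(d : ℤ), 0], ![t, ((N / d : ℕ) : ℤ)], ![(m : ℤ), 0], ![-n, ((N / m : ℕ) : ℤ)]} :
        Set (Fin 2 → ℤ))) ∧
    Nat.card ((Fin 2 → ℤ) ⧸ Submodule.span ℤ
      ({![(d : ℤ), 0], ![t, ((N / d : ℕ) : ℤ)], ![(m : ℤ), 0], ![-n, ((N / m : ℕ) : ℤ)]} :
        Set (Fin 2 → ℤ)))
      = Nat.gcd (N / m * d) (Nat.gcd (N / d * m)
          (((N / m : ℕ) : ℤ) * t + ((N / d : ℕ) : ℤ) * n).natAbs) := by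
  have hcross : N / d * d = N / m * m := by
    rw [Nat.div_mul_cancel hdN, Nat.div_mul_cancel hmN]
  have hA : 0 < N / d := Nat.div_pos (Nat.le_of_dvd hN hdN) hd
  generalize N / d = A at *
  generalize N / m = B at *
  have hgcd := gcd_mul_gcd_eq_gcd_cross hcross
  obtain ⟨a, b, hab, ha, hb⟩ := Nat.exists_coprime A B
  have hh : Nat.gcd A B ≠ 0 := (Nat.gcd_pos_of_pos_left _ hA).ne'
  generalize Nat.gcd A B = h at *
  subst ha hb
  obtain ⟨x, y, hxy⟩ := Nat.isCoprime_iff_coprime.mpr hab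
  have hk : Int.gcd (Int.gcd (d : ℤ) m) (b * t + a * n) ≠ 0 := by
    simp [Int.gcd_eq_zero_iff, hd.ne']
  have hcard := card_quotient_span_triangular hk hh (x * t - y * n)
  rw [← span_four_eq_span_triangular hxy] at hcard
  push_cast
  refine ⟨Nat.finite_of_card_ne_zero (hcard ▸ mul_ne_zero hk hh), hcard.trans ?_⟩
  have hc : ((b : ℤ) * h * t + a * h * n).natAbs = h * ((b : ℤ) * t + a * n).natAbs := by
    rw [show (b : ℤ) * h * t + a * h * n = h * (b * t + a * n) by ring, Int.natAbs_mul,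
      Int.natAbs_natCast]
  rw [hc, ← Nat.gcd_assoc, ← hgcd, Nat.gcd_mul_left, mul_comm]
  simp [Int.gcd_def]
end
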